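/- The non-negative coefficient synthesis problem for threshold automata is undecidable: there is no algorithm that, given an environment Env, a sketch threshold automaton TA over Env, and a location ℓ of TA, decides whether there exists a non-negative integer assignment μ to the indeterminates such that TA[μ] cannot cover ℓ. This holds even when the input sketch is required to be acyclic. -/

import Mathlib

namespace ThresholdAutomata

/-- A coefficient occurring in a threshold guard of a sketch: either a concrete
integer constant or an indeterminate (indeterminates are indexed by `ℕ`). -/
abbrev Coeff : Type := ℤ ⊕ ℕ

/-- The value of a coefficient under an integer assignment `μ` to the indeterminates. -/
def Coeff.eval (μ : ℕ → ℤ) : Coeff → ℤ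
  | .inl c => c
  | .inr x => μ x

/-- A threshold guard `b·x ⋈ a₀ + a₁·p₁ + … + a_|Π|·p_|Π|`, given as
`(b, x, isGe, a₀, [a₁, …])` where `x` is the index of a shared variable,
`isGe = true` means `⋈` is `≥` and `isGe = false` means `⋈` is `<`,
and each of `b, a₀, a₁, …` may be a constant or an indeterminate. -/
abbrev SGuard : Type := Coeff × ℕ × Bool × Coeff × List Coeff

/-- A rule `(from, to, φ, u)`: source location, target location, a conjunction of
threshold guards, and an update `u : Γ → {0,1}` of the shared variables
(the `j`-th entry of the list is `true` iff shared variable `j` is incremented). -/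
abbrev SRule : Type := ℕ × ℕ × List SGuard × List Bool

/-- A sketch threshold automaton `(|L|, I, |Γ|, R)`: locations are `0, …, |L| - 1`,
`I` is the list of initial locations, shared variables are `0, …, |Γ| - 1`, and
`R` is the list of rules. -/
abbrev Sketch : Type := ℕ × List ℕ × ℕ × List SRule

/-- A linear expression `c + Σᵢ aᵢ·pᵢ` over the environment variables,
given as `([a₀, …, a_{k-1}], c)`. -/
abbrev LinExpr : Type := List ℤ × ℤ

/-- The value of a linear expression at a valuation of the environment variables. -/
def LinExpr.evalAt (e : LinExpr) (pv : ℕ → ℕ) : ℤ :=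
  e.2 + ∑ i ∈ Finset.range e.1.length, e.1.getD i 0 * (pv i : ℤ)

/-- An environment `(|Π|, RC, N)`: environment variables are `0, …, |Π| - 1`,
the resilience condition `RC` is a linear formula given as a (conjunction of a)
list of linear constraints `e ≥ 0`, and the number function `N` is a linear
function of the environment variables. -/
abbrev Env : Type := ℕ × List LinExpr × LinExpr

/-- An instance of the coefficient synthesis problem: an environment `Env`,
a sketch `TA` and a location `ℓ` of `TA`. -/
abbrev Instance : Type := Env × Sketch × ℕ

/-- Satisfaction of a threshold guard by shared-variable values `g` and
environment-variable values `pv`, under an assignment `μ` to the indeterminates. -/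
def SGuard.sat (μ : ℕ → ℤ) (g : ℕ → ℕ) (pv : ℕ → ℕ) : SGuard → Prop
  | (b, x, isGe, a0, as) =>
      let lhs : ℤ := b.eval μ * (g x : ℤ)
      let rhs : ℤ := a0.eval μ +
        ∑ i ∈ Finset.range as.length, (as.getD i (.inl 0)).eval μ * (pv i : ℤ)
      if isGe then rhs ≤ lhs else lhs < rhs

/-- A configuration `σ = (κ, g, p)`: number of processes in each location,
values of the shared variables, values of the environment variables. -/
structure Config where
  κ : ℕ → ℕ
  g : ℕ → ℕ
  p : ℕ → ℕ

/-- `C` is a configuration of the automaton with environment `env` and sketch `TA`: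
the environment valuation satisfies the resilience condition, and the total number
of processes equals `N(p)`. -/
def Config.validFor (env : Env) (TA : Sketch) (C : Config) : Prop :=
  (∀ c ∈ env.2.1, 0 ≤ LinExpr.evalAt c C.p) ∧
  (∑ i ∈ Finset.range TA.1, C.κ i) = (LinExpr.evalAt env.2.2 C.p).toNat ∧
  (∀ i, TA.1 ≤ i → C.κ i = 0)

/-- An initial configuration: all processes are in initial locations and all
shared variables are `0`. -/
def Config.initialFor (env : Env) (TA : Sketch) (C : Config) : Prop :=
  C.validFor env TA ∧ (∀ i, i ∉ TA.2.1 → C.κ i = 0) ∧ (∀ j, C.g j = 0)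

/-- The step relation of `TA[μ]`: some rule whose source location is occupied and
whose guards are satisfied fires, moving one process from its source to its target
and adding its update to the shared variables. -/
def Step (TA : Sketch) (μ : ℕ → ℤ) (C C' : Config) : Prop :=
  ∃ r ∈ TA.2.2.2,
    0 < C.κ r.1 ∧ (∀ gd ∈ r.2.2.1, SGuard.sat μ C.g C.p gd) ∧
    (∀ i, C'.p i = C.p i) ∧
    (∀ j, C'.g j = C.g j + (if r.2.2.2.getD j false then 1 else 0)) ∧
    (∀ i, C'.κ i =
      if r.1 = r.2.1 then C.κ i
      else if i = r.1 then C.κ i - 1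
      else if i = r.2.1 then C.κ i + 1
      else C.κ i)

/-- `TA[μ]` can cover location `ℓ`: some initial configuration can reach a
configuration with at least one process in `ℓ`. -/
def Covers (env : Env) (TA : Sketch) (μ : ℕ → ℤ) (ℓ : ℕ) : Prop :=
  ∃ C C' : Config, C.initialFor env TA ∧
    Relation.ReflTransGen (Step TA μ) C C' ∧ 0 < C'.κ ℓ

/-- The sketch is acyclic: the directed graph on the locations with an edge
`(r.from, r.to)` for each rule `r` has no cycles. -/
def SketchAcyclic (TA : Sketch) : Prop :=
  ∀ a : ℕ, ¬ Relation.TransGen (fun u w => ∃ r ∈ TA.2.2.2, r.1 = u ∧ r.2.1 = w) a a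

section

open Dioph

/-! ### Diophantine functions: binomials, factorials, products -/

theorem sum_digits_lt (B : ℕ) (c : ℕ → ℕ) (hc : ∀ i, c i < B) (k : ℕ) :
    ∑ i ∈ Finset.range k, c i * B ^ i < B ^ k := by
  induction k with
  | zero => simp
  | succ k ih =>
    rw [Finset.sum_range_succ, pow_succ]
    have h1 : (c k + 1) * B ^ k ≤ B * B ^ k := Nat.mul_le_mul_right _ (hc k)
    nlinarith

theorem choose_eq_digit (n k : ℕ) :
    n.choose k = ((2 ^ n + 2) ^ n / (2 ^ n + 1) ^ k) % (2 ^ n + 1) := by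
  set B := 2 ^ n + 1 with hB
  have hBpos : 0 < B := by rw [hB]; positivity
  have hlt : ∀ i, n.choose i < B := fun i => by
    have := Nat.choose_le_two_pow n i
    omega
  have hexp : (2 ^ n + 2) ^ n = ∑ i ∈ Finset.range (n + k + 1), n.choose i * B ^ i := by
    have h2 : 2 ^ n + 2 = B + 1 := by omega
    rw [h2, add_pow]
    rw [show n + k + 1 = (n + 1) + k by ring, Finset.sum_range_add _ (n + 1) k]
    have : ∑ x ∈ Finset.range k, n.choose (n + 1 + x) * B ^ (n + 1 + x) = 0 := by
      apply Finset.sum_eq_zero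
      intro x _
      rw [Nat.choose_eq_zero_of_lt (by omega)]; simp
    rw [this, add_zero]
    apply Finset.sum_congr rfl
    intro i _
    simp [mul_comm]
  have hsplit : (2 ^ n + 2) ^ n = (∑ i ∈ Finset.range k, n.choose i * B ^ i) +
      B ^ k * (n.choose k + B * ∑ i ∈ Finset.range n, n.choose (k + 1 + i) * B ^ i) := by
    rw [hexp, show n + k + 1 = k + 1 + n by ring, Finset.sum_range_add _ (k + 1) n, Finset.sum_range_succ,
      mul_add, Finset.mul_sum, Finset.mul_sum]
    rw [add_assoc]
    congr 2
    · ring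
    · apply Finset.sum_congr rfl
      intro i _
      ring
  rw [hsplit, Nat.add_mul_div_left _ _ (by positivity),
    Nat.div_eq_of_lt (sum_digits_lt B _ hlt k), zero_add, Nat.add_mul_mod_self_left,
    Nat.mod_eq_of_lt (hlt k)]

theorem factorial_eq_div (n : ℕ) :
    n.factorial = (n ^ n * n ^ 2 + n ^ 2 + 1 + n) ^ n /
      (n ^ n * n ^ 2 + n ^ 2 + 1 + n).choose n := by
  set s := n ^ n * n ^ 2 + n ^ 2 + 1 with hs
  set r := s + n with hr
  have hd : n.factorial * r.choose n = r.descFactorial n :=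
    (Nat.descFactorial_eq_factorial_mul_choose r n).symm
  have hcpos : 0 < r.choose n := Nat.choose_pos (by omega)
  have hle : r.descFactorial n ≤ r ^ n := Nat.descFactorial_le_pow r n
  symm
  rw [Nat.div_eq_iff hcpos]
  have hlow : s ^ n ≤ r.descFactorial n := by
    refine le_trans ?_ (Nat.pow_sub_le_descFactorial r n)
    exact Nat.pow_le_pow_left (by omega) n
  -- r^n < s^n + ... : bound by Bernoulli
  have key : n.factorial * r ^ n < (n.factorial + 1) * s ^ n := by
    rcases Nat.eq_zero_or_pos n with h0 | hn
    · subst h0; simp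
    have hfn : n.factorial ≤ n ^ n := Nat.factorial_le_pow n
    have hspos : 0 < s := by omega
    -- s^n * r ≥ r^n * (r - n*n)
    have bern : r ^ n * ((r : ℤ) - n * n) ≤ s ^ n * (r : ℤ) := by
      have hb : (1 : ℚ) + n * (-(n / r : ℚ)) ≤ (1 + -(n / r : ℚ)) ^ n := by
        apply one_add_mul_le_pow
        have : (n / r : ℚ) ≤ 1 := by
          apply div_le_one_of_le₀
          · exact_mod_cast (by omega : n ≤ r)
          · positivity
        linarith
      have hr0 : (0 : ℚ) < r := by exact_mod_cast (by omega : 0 < r)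
      have e1 : (1 + -(n / r : ℚ)) = s / r := by
        have : (r : ℚ) = s + n := by rw [hr]; push_cast; ring
        field_simp
        linarith
      rw [e1, div_pow] at hb
      have e2 : (1 : ℚ) + n * (-(n / r : ℚ)) = (r - n * n) / r := by field_simp; ring
      rw [e2, div_le_div_iff₀ hr0 (by positivity)] at hb
      have : ((r : ℚ) ^ n * (r - n * n)) ≤ s ^ n * r := by linarith
      exact_mod_cast this
    have hr' : (n.factorial + 1) * (n * n) < r := by
      rw [hr, hs]; nlinarith
    -- f * r^n * (r) < (f+1) * r^n * (r - n*n)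
    have h3 : (n.factorial : ℤ) * r < (n.factorial + 1) * ((r : ℤ) - n * n) := by
      have : (((n.factorial + 1) * (n * n) : ℕ) : ℤ) < r := by exact_mod_cast hr'
      push_cast at this
      linarith
    have hrn : (0 : ℤ) < (r : ℤ) ^ n := by
      have : (0 : ℤ) < r := by exact_mod_cast (by omega : 0 < r)
      positivity
    have h4 : (n.factorial : ℤ) * r ^ n * r < (n.factorial + 1) * s ^ n * r := by
      calc (n.factorial : ℤ) * r ^ n * r = r ^ n * (n.factorial * r) := by ring
        _ < r ^ n * ((n.factorial + 1) * ((r : ℤ) - n * n)) := by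
          exact mul_lt_mul_of_pos_left h3 hrn
        _ = (n.factorial + 1) * (r ^ n * ((r : ℤ) - n * n)) := by ring
        _ ≤ (n.factorial + 1) * (s ^ n * r) := by
          apply mul_le_mul_of_nonneg_left bern; positivity
        _ = _ := by ring
    have h5 := lt_of_mul_lt_mul_right h4 (by positivity)
    exact_mod_cast h5
  constructor
  · rw [hd]; exact hle
  · have h6 : (n.factorial + 1) * s ^ n ≤ (n.factorial + 1) * r.descFactorial n :=
      Nat.mul_le_mul_left _ hlow
    rw [← hd] at h6
    have h7 : n.factorial * r ^ n < n.factorial * ((n.factorial + 1) * r.choose n) := by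
      calc _ < _ := key
        _ ≤ _ := h6
        _ = _ := by ring
    have h8 := lt_of_mul_lt_mul_left h7 (Nat.zero_le _)
    have h9 : (n.factorial + 1) * r.choose n = n.factorial * r.choose n + r.choose n := by ring
    omega

theorem prod_eq_mod (y T : ℕ) (hT : 0 < T) :
    ∏ k ∈ Finset.range y, (1 + (k + 1) * T) =
      (T ^ y * (y.factorial * (T * ((1 + y * T) ^ y) ^ 2 + y).choose y)) %
        (T * (1 + y * T) ^ y + 1) := by
  set X := (1 + y * T) ^ y with hX
  set q := T * X ^ 2 with hq
  rw [← Nat.ascFactorial_eq_factorial_mul_choose]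
  have hbound : ∏ k ∈ Finset.range y, (1 + (k + 1) * T) ≤ X := by
    calc _ ≤ ∏ k ∈ Finset.range y, (1 + y * T) := by
          apply Finset.prod_le_prod'
          intro k hk
          have : k + 1 ≤ y := by simpa using hk
          have := Nat.mul_le_mul_right T this
          omega
      _ = X := by simp [hX]
  have hlt : ∏ k ∈ Finset.range y, (1 + (k + 1) * T) < T * X + 1 := by nlinarith
  have hasc : T ^ y * (q + 1).ascFactorial y = ∏ k ∈ Finset.range y, (T * q + (k + 1) * T) := by
    rw [Nat.ascFactorial_eq_prod_range, ← Finset.card_range y, ← Finset.prod_const,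
      Finset.card_range, ← Finset.prod_mul_distrib]
    apply Finset.prod_congr rfl
    intro k _
    ring
  rw [hasc]
  have hTq : T * q ≡ 1 [MOD T * X + 1] := by
    have : T * q = (T * X) * (T * X) := by rw [hq]; ring
    rw [this]
    apply Nat.ModEq.symm
    rw [Nat.modEq_iff_dvd]
    refine ⟨(T * X : ℤ) - 1, ?_⟩
    push_cast
    ring
  have hcong : ∏ k ∈ Finset.range y, (T * q + (k + 1) * T) ≡
      ∏ k ∈ Finset.range y, (1 + (k + 1) * T) [MOD T * X + 1] := by
    apply Nat.ModEq.prod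
    intro k _
    exact hTq.add_right _
  exact (Nat.mod_eq_of_modEq hcong hlt).symm

section
variable {α : Type} {f g h : (α → ℕ) → ℕ}

theorem cd (n : ℕ) : DiophFn (fun _ : α → ℕ => n) := Dioph.const_dioph n

theorem dex {R : (α → ℕ) → ℕ → Prop}
    (d : Dioph {w : Option α → ℕ | R (fun i => w (some i)) (w none)}) :
    Dioph {v | ∃ x, R v x} :=
  (ex1_dioph d).ext fun _ => Iff.rfl

theorem dlift (df : DiophFn f) : DiophFn (fun w : Option α → ℕ => f (fun i => w (some i))) :=
  reindex_diophFn some df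

theorem dnone : DiophFn (fun w : Option α → ℕ => w none) := proj_dioph none

theorem dand {P Q : (α → ℕ) → Prop} (hP : Dioph {v | P v}) (hQ : Dioph {v | Q v}) :
    Dioph {v | P v ∧ Q v} := hP.inter hQ

theorem dor {P Q : (α → ℕ) → Prop} (hP : Dioph {v | P v}) (hQ : Dioph {v | Q v}) :
    Dioph {v | P v ∨ Q v} := hP.union hQ

theorem fn_of_graph (H : Dioph {w : Option α → ℕ | w none = f (fun i => w (some i))}) :
    DiophFn f := H.ext fun _ => eq_comm

theorem choose_dioph (df : DiophFn f) (dg : DiophFn g) :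
    DiophFn fun v => (f v).choose (g v) := by
  simp only [choose_eq_digit]
  have h2 := pow_dioph (cd 2) df
  exact mod_dioph (div_dioph (pow_dioph (add_dioph h2 (cd 2)) df)
    (pow_dioph (add_dioph h2 (cd 1)) dg)) (add_dioph h2 (cd 1))

theorem factorial_dioph (df : DiophFn f) : DiophFn fun v => (f v).factorial := by
  have e : ∀ v, (f v).factorial = _ := fun v => factorial_eq_div (f v)
  simp only [e]
  have hr := add_dioph (add_dioph (add_dioph (mul_dioph (pow_dioph df df) (pow_dioph df (cd 2)))
    (pow_dioph df (cd 2))) (cd 1)) df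
  exact div_dioph (pow_dioph hr df) (choose_dioph hr df)

/-- Product of an arithmetic progression, with step `T!`. -/
def prodAP (y Q : ℕ) : ℕ := ∏ k ∈ Finset.range y, (1 + (k + 1) * Q.factorial)

theorem prodAP_dioph (df : DiophFn f) (dg : DiophFn g) :
    DiophFn fun v => prodAP (f v) (g v) := by
  have e : ∀ v, prodAP (f v) (g v) = _ := fun v =>
    prod_eq_mod (f v) (g v).factorial (Nat.factorial_pos _)
  simp only [e]
  have hT := factorial_dioph dg
  have hX := pow_dioph (add_dioph (cd 1) (mul_dioph df hT)) df
  exact mod_dioph (mul_dioph (pow_dioph hT df) (mul_dioph (factorial_dioph df)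
    (choose_dioph (add_dioph (mul_dioph hT (pow_dioph hX (cd 2))) df) df)))
    (add_dioph (mul_dioph hT hX) (cd 1))

theorem pair_dioph (df : DiophFn f) (dg : DiophFn g) :
    DiophFn fun v => Nat.pair (f v) (g v) := by
  apply fn_of_graph
  have df' := dlift df
  have dg' := dlift dg
  refine (dor (dand (lt_dioph df' dg') (eq_dioph dnone (add_dioph (mul_dioph dg' dg') df')))
    (dand (le_dioph dg' df')
      (eq_dioph dnone (add_dioph (add_dioph (mul_dioph df' df') df') dg')))).ext ?_
  intro w
  simp only [Set.mem_ofPred_eq, Nat.pair]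
  split_ifs with h
  · constructor
    · rintro (⟨_, h⟩ | ⟨h', _⟩)
      · exact h
      · omega
    · intro h'; exact Or.inl ⟨h, h'⟩
  · constructor
    · rintro (⟨h', _⟩ | ⟨_, h'⟩)
      · omega
      · exact h'
    · intro h'; exact Or.inr ⟨by omega, h'⟩

theorem fst_dioph (df : DiophFn f) : DiophFn fun v => (Nat.unpair (f v)).1 := by
  apply fn_of_graph
  refine (dex (R := fun w x => Nat.pair (w none) x = f (fun i => w (some i)))
    (eq_dioph (pair_dioph (dlift dnone) dnone) (dlift (dlift df)))).ext ?_
  intro w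
  simp only [Set.mem_ofPred_eq]
  constructor
  · rintro ⟨x, hx⟩; rw [← hx]; simp
  · intro h; exact ⟨_, by rw [h, Nat.pair_unpair]⟩

theorem snd_dioph (df : DiophFn f) : DiophFn fun v => (Nat.unpair (f v)).2 := by
  apply fn_of_graph
  refine (dex (R := fun w x => Nat.pair x (w none) = f (fun i => w (some i)))
    (eq_dioph (pair_dioph dnone (dlift dnone)) (dlift (dlift df)))).ext ?_
  intro w
  simp only [Set.mem_ofPred_eq]
  constructor
  · rintro ⟨x, hx⟩; rw [← hx]; simp
  · intro h; exact ⟨_, by rw [h, Nat.pair_unpair]⟩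

theorem beta_dioph (df : DiophFn f) (dg : DiophFn g) :
    DiophFn fun v => Nat.beta (f v) (g v) :=
  mod_dioph (fst_dioph df) (add_dioph (mul_dioph (add_dioph dg (cd 1)) (snd_dioph df)) (cd 1))

end

end

section

open Dioph

/-! ### Polynomial expressions with natural coefficients -/

/-- Polynomial expressions over `ℕ`. -/
inductive NExpr (γ : Type) : Type
  | var : γ → NExpr γ
  | const : ℕ → NExpr γ
  | add : NExpr γ → NExpr γ → NExpr γ
  | mul : NExpr γ → NExpr γ → NExpr γ

namespace NExpr
variable {γ : Type}

/-- Evaluation of an expression. -/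
def eval (x : γ → ℕ) : NExpr γ → ℕ
  | var i => x i
  | const c => c
  | add a b => a.eval x + b.eval x
  | mul a b => a.eval x * b.eval x

/-- The variables of an expression. -/
def vars : NExpr γ → List γ
  | var i => [i]
  | const _ => []
  | add a b => a.vars ++ b.vars
  | mul a b => a.vars ++ b.vars

theorem eval_modEq {q : ℕ} {x x' : γ → ℕ} (e : NExpr γ)
    (h : ∀ i ∈ e.vars, x i ≡ x' i [MOD q]) : e.eval x ≡ e.eval x' [MOD q] := by
  induction e with
  | var i => exact h i (by simp [vars])
  | const c => exact Nat.ModEq.refl _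
  | add a b iha ihb =>
    exact (iha fun i hi => h i (by simp [vars, hi])).add (ihb fun i hi => h i (by simp [vars, hi]))
  | mul a b iha ihb =>
    exact (iha fun i hi => h i (by simp [vars, hi])).mul (ihb fun i hi => h i (by simp [vars, hi]))

theorem eval_mono {x x' : γ → ℕ} (e : NExpr γ)
    (h : ∀ i ∈ e.vars, x i ≤ x' i) : e.eval x ≤ e.eval x' := by
  induction e with
  | var i => exact h i (by simp [vars])
  | const c => exact le_rfl
  | add a b iha ihb =>
    exact Nat.add_le_add (iha fun i hi => h i (by simp [vars, hi]))
      (ihb fun i hi => h i (by simp [vars, hi]))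
  | mul a b iha ihb =>
    exact Nat.mul_le_mul (iha fun i hi => h i (by simp [vars, hi]))
      (ihb fun i hi => h i (by simp [vars, hi]))

theorem eval_dioph {α : Type} (e : NExpr γ) (F : γ → (α → ℕ) → ℕ) (hF : ∀ i, DiophFn (F i)) :
    DiophFn fun v => e.eval fun i => F i v := by
  induction e with
  | var i => exact hF i
  | const c => exact cd c
  | add a b iha ihb => exact add_dioph iha ihb
  | mul a b iha ihb => exact mul_dioph iha ihb

theorem of_isPoly {f : (γ → ℕ) → ℤ} (hf : IsPoly f) :
    ∃ p n : NExpr γ, ∀ x, f x = (p.eval x : ℤ) - n.eval x := by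
  induction hf with
  | proj i => exact ⟨var i, const 0, fun x => by simp [eval]⟩
  | const c =>
    refine ⟨const c.toNat, const (-c).toNat, fun x => ?_⟩
    simp only [eval]; omega
  | sub _ _ ih1 ih2 =>
    obtain ⟨p1, n1, h1⟩ := ih1
    obtain ⟨p2, n2, h2⟩ := ih2
    refine ⟨add p1 n2, add n1 p2, fun x => ?_⟩
    simp only [h1, h2, eval]; push_cast; ring
  | mul _ _ ih1 ih2 =>
    obtain ⟨p1, n1, h1⟩ := ih1
    obtain ⟨p2, n2, h2⟩ := ih2
    refine ⟨add (mul p1 p2) (mul n1 n2), add (mul p1 n2) (mul n1 p2), fun x => ?_⟩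
    simp only [h1, h2, eval]; push_cast; ring

end NExpr

theorem exists_expr {α : Type} {S : Set (α → ℕ)} (d : Dioph S) :
    ∃ (β : Type) (p n : NExpr (α ⊕ β)), ∀ v, v ∈ S ↔
      ∃ t, p.eval (Sum.elim v t) = n.eval (Sum.elim v t) := by
  obtain ⟨β, P, hP⟩ := d
  obtain ⟨p, n, h⟩ := NExpr.of_isPoly P.isPoly
  refine ⟨β, p, n, fun v => (hP v).trans (exists_congr fun t => ?_)⟩
  rw [h]; omega

/-! ### Bounded universal quantification -/

theorem prodAP_factor_dvd {y Q k : ℕ} (hk : k < y) :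
    1 + (k + 1) * Q.factorial ∣ prodAP y Q :=
  Finset.dvd_prod_of_mem (fun k => 1 + (k + 1) * Q.factorial) (Finset.mem_range.2 hk)

theorem ap_coprime {y Q i j : ℕ} (hy : y ≤ Q) (hi : i < y) (hj : j < y) (hij : i ≠ j) :
    Nat.Coprime (1 + (i + 1) * Q.factorial) (1 + (j + 1) * Q.factorial) := by
  wlog h : i < j generalizing i j
  · exact (this hj hi hij.symm (by omega)).symm
  rw [add_comm 1, add_comm 1]
  apply Nat.coprime_mul_succ
  exact Nat.dvd_factorial (by omega) (by omega)

theorem prodAP_dvd {y Q X : ℕ} (hy : y ≤ Q)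
    (h : ∀ k < y, 1 + (k + 1) * Q.factorial ∣ X) : prodAP y Q ∣ X := by
  apply Finset.prod_dvd_of_isRelPrime
  · intro i hi j hj hij
    have hi' : i < y := by simpa using hi
    have hj' : j < y := by simpa using hj
    exact Nat.coprime_iff_isRelPrime.1 (ap_coprime hy hi' hj' hij)
  · intro k hk
    exact h k (by simpa using hk)

theorem prodAP_modEq {y Q X Y : ℕ} (hy : y ≤ Q)
    (h : ∀ k < y, X ≡ Y [MOD 1 + (k + 1) * Q.factorial]) : X ≡ Y [MOD prodAP y Q] := by
  wlog hXY : X ≤ Y generalizing X Y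
  · exact (this (fun k hk => (h k hk).symm) (by omega)).symm
  rw [Nat.modEq_iff_dvd' hXY]
  apply prodAP_dvd hy
  intro k hk
  rw [← Nat.modEq_iff_dvd' hXY]
  exact h k hk

theorem ap_crt {y Q : ℕ} (hy : y ≤ Q) (s : ℕ → ℕ) :
    ∃ a, ∀ k < y, a ≡ s k [MOD 1 + (k + 1) * Q.factorial] := by
  obtain ⟨a, ha⟩ := Nat.chineseRemainderOfFinset s (fun k => 1 + (k + 1) * Q.factorial)
    (Finset.range y) (by intro i _; simp)
    (by
      intro i hi j hj hij
      exact ap_coprime hy (by simpa using hi) (by simpa using hj) hij)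
  exact ⟨a, fun k hk => ha k (by simpa using hk)⟩

theorem bounded_core {α β : Type} (p n : NExpr (Option α ⊕ β)) (L : List β)
    (hLp : ∀ b, Sum.inr b ∈ p.vars → b ∈ L) (hLn : ∀ b, Sum.inr b ∈ n.vars → b ∈ L)
    (v : α → ℕ) (y : ℕ) :
    (∀ k < y, ∃ t : β → ℕ, p.eval (Sum.elim (Option.elim' k v) t) =
        n.eval (Sum.elim (Option.elim' k v) t)) ↔
      ∃ u Q c, ∃ a : β → ℕ,
        p.eval (Sum.elim (Option.elim' y v) fun _ => u) +
          n.eval (Sum.elim (Option.elim' y v) fun _ => u) ≤ Q ∧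
        prodAP y Q ∣ 1 + (c + 1) * Q.factorial ∧
        p.eval (Sum.elim (Option.elim' c v) a) ≡ n.eval (Sum.elim (Option.elim' c v) a)
          [MOD prodAP y Q] ∧
        ∀ b ∈ L, prodAP y Q ∣ (a b).descFactorial (u + 1) := by
  classical
  constructor
  · intro H
    choose! t ht using H
    obtain ⟨u, hu⟩ : ∃ u, ∀ k < y, ∀ b ∈ L, t k b ≤ u := by
      refine ⟨∑ k ∈ Finset.range y, ∑ b ∈ L.toFinset, t k b, fun k hk b hb => ?_⟩
      calc t k b ≤ ∑ b ∈ L.toFinset, t k b :=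
            Finset.single_le_sum (f := fun b => t k b) (fun _ _ => Nat.zero_le _)
              (List.mem_toFinset.2 hb)
        _ ≤ _ := Finset.single_le_sum (f := fun k => ∑ b ∈ L.toFinset, t k b)
              (fun _ _ => Nat.zero_le _) (Finset.mem_range.2 hk)
    obtain ⟨Q, hQ, hyQ⟩ : ∃ Q, p.eval (Sum.elim (Option.elim' y v) fun _ => u) +
          n.eval (Sum.elim (Option.elim' y v) fun _ => u) ≤ Q ∧ y ≤ Q :=
      ⟨_, Nat.le_add_right _ y, Nat.le_add_left _ _⟩
    obtain ⟨c, hc⟩ := ap_crt hyQ (fun k => k)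
    have ha : ∀ b, ∃ a, ∀ k < y, a ≡ t k b [MOD 1 + (k + 1) * Q.factorial] := fun b =>
      ap_crt hyQ (fun k => t k b)
    choose a ha using ha
    refine ⟨u, Q, c, a, hQ, ?_, ?_, ?_⟩
    · apply prodAP_dvd hyQ
      intro k hk
      have h1 : 1 + (c + 1) * Q.factorial ≡ 1 + (k + 1) * Q.factorial
          [MOD 1 + (k + 1) * Q.factorial] :=
        (((hc k hk).add_right 1).mul_right _).add_left 1
      exact (Nat.modEq_zero_iff_dvd.1 (h1.trans (Nat.modEq_zero_iff_dvd.2 dvd_rfl)))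
    · apply prodAP_modEq hyQ
      intro k hk
      have hx : ∀ i : Option α ⊕ β, Sum.elim (Option.elim' c v) a i ≡
          Sum.elim (Option.elim' k v) (t k) i [MOD 1 + (k + 1) * Q.factorial] := by
        rintro ((_ | i) | b)
        · exact hc k hk
        · exact Nat.ModEq.refl _
        · exact ha b k hk
      refine (p.eval_modEq fun i _ => hx i).trans ?_
      rw [ht k hk]
      exact (n.eval_modEq fun i _ => hx i).symm
    · intro b hb
      apply prodAP_dvd hyQ
      intro k hk
      by_cases hab : a b < u + 1
      · rw [Nat.descFactorial_eq_zero_iff_lt.2 hab]; exact dvd_zero _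
      · rw [Nat.descFactorial_eq_prod_range]
        have htu := hu k hk b hb
        refine dvd_trans ?_ (Finset.dvd_prod_of_mem (fun i => a b - i)
          (Finset.mem_range.2 (Nat.lt_succ_of_le htu)))
        exact (Nat.modEq_iff_dvd' (by omega)).1 (ha b k hk).symm
  · rintro ⟨u, Q, c, a, hQ, hc, hpn, hL⟩ k hk
    have hm1 : 1 + (k + 1) * Q.factorial ≠ 1 := by
      have := Q.factorial_pos
      have : 0 < (k + 1) * Q.factorial := by positivity
      omega
    obtain ⟨q, hq, hqd⟩ := Nat.exists_prime_and_dvd hm1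
    have hqM : q ∣ prodAP y Q := hqd.trans (prodAP_factor_dvd hk)
    have hqT : ¬ q ∣ Q.factorial := by
      intro h
      have := (Nat.dvd_add_left (h.mul_left (k + 1))).1 hqd
      exact hq.one_lt.ne' (Nat.dvd_one.1 this)
    have hqQ : Q < q := by
      by_contra h
      exact hqT ((hq.dvd_factorial).2 (by omega))
    have hck : c ≡ k [MOD q] := by
      have h1 : 1 + (c + 1) * Q.factorial ≡ 1 + (k + 1) * Q.factorial [MOD q] :=
        (Nat.modEq_zero_iff_dvd.2 (hqM.trans hc)).trans (Nat.modEq_zero_iff_dvd.2 hqd).symm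
      have h2 := Nat.ModEq.add_left_cancel' 1 h1
      have h3 := Nat.ModEq.cancel_right_of_coprime ((hq.coprime_iff_not_dvd).2 hqT) h2
      exact Nat.ModEq.add_right_cancel' 1 h3
    have hz : ∀ b, ∃ z, b ∈ L → z ≤ u ∧ a b ≡ z [MOD q] := by
      intro b
      by_cases hb : b ∈ L
      · have h1 := hqM.trans (hL b hb)
        rw [Nat.descFactorial_eq_prod_range, hq.prime.dvd_finsetProd_iff] at h1
        obtain ⟨j, hj, hd⟩ := h1
        have hj' : j < u + 1 := by simpa using hj
        by_cases hja : j ≤ a b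
        · exact ⟨j, fun _ => ⟨by omega, ((Nat.modEq_iff_dvd' hja).2 hd).symm⟩⟩
        · exact ⟨a b, fun _ => ⟨by omega, Nat.ModEq.refl _⟩⟩
      · exact ⟨0, fun h => absurd h hb⟩
    choose t ht using hz
    refine ⟨t, ?_⟩
    have hx : ∀ e : NExpr (Option α ⊕ β), (∀ b, Sum.inr b ∈ e.vars → b ∈ L) →
        e.eval (Sum.elim (Option.elim' c v) a) ≡ e.eval (Sum.elim (Option.elim' k v) t)
          [MOD q] := by
      intro e he
      apply e.eval_modEq
      rintro ((_ | i) | b) hi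
      · exact hck
      · exact Nat.ModEq.refl _
      · exact (ht b (he b hi)).2
    have hb : ∀ e : NExpr (Option α ⊕ β), (∀ b, Sum.inr b ∈ e.vars → b ∈ L) →
        e.eval (Sum.elim (Option.elim' k v) t) ≤
          e.eval (Sum.elim (Option.elim' y v) fun _ => u) := by
      intro e he
      apply e.eval_mono
      rintro ((_ | i) | b) hi
      · exact hk.le
      · exact le_rfl
      · exact (ht b (he b hi)).1
    have hp := hb p hLp
    have hn := hb n hLn
    have hmod := ((hx p hLp).symm.trans (hpn.of_dvd hqM)).trans (hx n hLn)
    exact Nat.ModEq.eq_of_lt_of_lt hmod (by omega) (by omega)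

theorem dlist {α β : Type} (L : List β) (F : β → (α → ℕ) → Prop)
    (hF : ∀ b, Dioph {v | F b v}) : Dioph {v | ∀ b ∈ L, F b v} := by
  induction L with
  | nil => exact (eq_dioph (cd 0) (cd 0)).ext fun v => by simp
  | cons b L ih => exact (dand (hF b) ih).ext fun v => by simp

theorem dball {α : Type} {R : (α → ℕ) → ℕ → Prop} {f : (α → ℕ) → ℕ}
    (d : Dioph {w : Option α → ℕ | R (fun i => w (some i)) (w none)}) (df : DiophFn f) :
    Dioph {v | ∀ k < f v, R v k} := by
  classical
  obtain ⟨β, p, n, h⟩ := exists_expr d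
  let L : List β := (p.vars ++ n.vars).filterMap Sum.getRight?
  have hLp : ∀ b, Sum.inr b ∈ p.vars → b ∈ L := fun b hb =>
    List.mem_filterMap.2 ⟨Sum.inr b, by simp [hb], rfl⟩
  have hLn : ∀ b, Sum.inr b ∈ n.vars → b ∈ L := fun b hb =>
    List.mem_filterMap.2 ⟨Sum.inr b, by simp [hb], rfl⟩
  have hR : ∀ v k, R v k ↔ ∃ t : β → ℕ, p.eval (Sum.elim (Option.elim' k v) t) =
        n.eval (Sum.elim (Option.elim' k v) t) := fun v k => h (Option.elim' k v)
  refine Dioph.ext (S := {v | ∃ u Q c, ∃ a : β → ℕ,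
        p.eval (Sum.elim (Option.elim' (f v) v) fun _ => u) +
          n.eval (Sum.elim (Option.elim' (f v) v) fun _ => u) ≤ Q ∧
        prodAP (f v) Q ∣ 1 + (c + 1) * Q.factorial ∧
        p.eval (Sum.elim (Option.elim' c v) a) ≡ n.eval (Sum.elim (Option.elim' c v) a)
          [MOD prodAP (f v) Q] ∧
        ∀ b ∈ L, prodAP (f v) Q ∣ (a b).descFactorial (u + 1)}) ?_ ?_
  · refine dex (dex (dex ?_))
    let A := Option (Option (Option α)) ⊕ β
    let U : (A → ℕ) → ℕ := fun w => w (Sum.inl (some (some none)))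
    let Q : (A → ℕ) → ℕ := fun w => w (Sum.inl (some none))
    let C : (A → ℕ) → ℕ := fun w => w (Sum.inl none)
    let V : (A → ℕ) → α → ℕ := fun w i => w (Sum.inl (some (some (some i))))
    have dU : DiophFn U := proj_dioph _
    have dQ : DiophFn Q := proj_dioph _
    have dC : DiophFn C := proj_dioph _
    have dV : ∀ i, DiophFn (fun w => V w i) := fun i => proj_dioph _
    have dB : ∀ b, DiophFn (fun w : A → ℕ => w (Sum.inr b)) := fun b => proj_dioph _
    have dfV : DiophFn fun w => f (V w) := reindex_diophFn (fun i => Sum.inl (some (some (some i)))) df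
    have dM := prodAP_dioph dfV dQ
    have ev1 : ∀ e : NExpr (Option α ⊕ β), DiophFn fun w =>
        e.eval (Sum.elim (Option.elim' (f (V w)) (V w)) fun _ => U w) := by
      intro e
      have := e.eval_dioph (fun i w => (Sum.elim (Option.elim' (f (V w)) (V w)) fun _ => U w) i)
        (by
          rintro ((_ | i) | b)
          · exact dfV
          · exact dV i
          · exact dU)
      exact this
    have ev2 : ∀ e : NExpr (Option α ⊕ β), DiophFn fun w : A → ℕ =>
        e.eval (Sum.elim (Option.elim' (C w) (V w)) fun b => w (Sum.inr b)) := by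
      intro e
      have := e.eval_dioph (fun i w => (Sum.elim (Option.elim' (C w) (V w))
          fun b => w (Sum.inr b)) i)
        (by
          rintro ((_ | i) | b)
          · exact dC
          · exact dV i
          · exact dB b)
      exact this
    have main := dand (le_dioph (add_dioph (ev1 p) (ev1 n)) dQ)
      (dand (dvd_dioph dM (add_dioph (cd 1) (mul_dioph (add_dioph dC (cd 1)) (factorial_dioph dQ))))
      (dand (modEq_dioph (ev2 p) (ev2 n) dM)
      (dlist L (fun b w => prodAP (f (V w)) (Q w) ∣
          (U w + 1).factorial * (w (Sum.inr b)).choose (U w + 1)) (fun b =>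
        dvd_dioph dM (mul_dioph (factorial_dioph (add_dioph dU (cd 1)))
          (choose_dioph (dB b) (add_dioph dU (cd 1))))))))
    refine (ex_dioph main).ext ?_
    intro w
    simp only [← Nat.descFactorial_eq_factorial_mul_choose]
    exact Iff.rfl
  · intro v
    refine (bounded_core p n L hLp hLn v (f v)).symm.trans ?_
    exact forall_congr' fun k => forall_congr' fun _ => (hR v k).symm

/-! ### Graphs of partial recursive functions are Diophantine -/

theorem exists_beta (s : ℕ → ℕ) (n : ℕ) : ∃ c, ∀ i < n, Nat.beta c i = s i := by
  refine ⟨Nat.unbeta ((List.range n).map s), fun i hi => ?_⟩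
  have := Nat.beta_unbeta_coe ((List.range n).map s) ⟨i, by simpa using hi⟩
  simpa using this

theorem prec_iff (f g : ℕ →. ℕ) (a n b : ℕ) :
    b ∈ (Nat.rec (f a) (fun y IH => do let i ← IH; g (Nat.pair a (Nat.pair y i))) n : Part ℕ) ↔
      ∃ s, Nat.beta s 0 ∈ f a ∧ Nat.beta s n = b ∧
        ∀ i < n, Nat.beta s (i + 1) ∈ g (Nat.pair a (Nat.pair i (Nat.beta s i))) := by
  have key : b ∈ (Nat.rec (f a) (fun y IH => do let i ← IH; g (Nat.pair a (Nat.pair y i))) n : Part ℕ) ↔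
      ∃ s : ℕ → ℕ, s 0 ∈ f a ∧ s n = b ∧
        ∀ i < n, s (i + 1) ∈ g (Nat.pair a (Nat.pair i (s i))) := by
    induction n generalizing b with
    | zero =>
      constructor
      · intro h; exact ⟨fun _ => b, h, rfl, by simp⟩
      · rintro ⟨s, h0, h1, _⟩; rw [← h1]; exact h0
    | succ n ih =>
      constructor
      · intro h
        obtain ⟨i, hi, hg⟩ := Part.mem_bind_iff.1 h
        obtain ⟨s, h0, h1, h2⟩ := (ih i).1 hi
        refine ⟨fun j => if j ≤ n then s j else b, by simpa using h0, by simp, ?_⟩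
        intro j hj
        rcases Nat.lt_succ_iff_lt_or_eq.1 hj with hj | rfl
        · simpa [hj.le, Nat.succ_le_of_lt hj] using h2 j hj
        · simpa [h1] using hg
      · rintro ⟨s, h0, h1, h2⟩
        refine Part.mem_bind_iff.2 ⟨s n, (ih _).2 ⟨s, h0, rfl, fun i hi => h2 i (by omega)⟩, ?_⟩
        rw [← h1]; exact h2 n (by omega)
  rw [key]
  constructor
  · rintro ⟨s, h0, h1, h2⟩
    obtain ⟨c, hc⟩ := exists_beta s (n + 1)
    refine ⟨c, ?_, ?_, ?_⟩
    · rw [hc 0 (by omega)]; exact h0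
    · rw [hc n (by omega)]; exact h1
    · intro i hi
      rw [hc i (by omega), hc (i + 1) (by omega)]; exact h2 i hi
  · rintro ⟨s, h⟩
    exact ⟨Nat.beta s, h⟩

theorem partrec_dioph {F : ℕ →. ℕ} (hF : Nat.Partrec F) :
    ∀ {α : Type} {x y : (α → ℕ) → ℕ}, DiophFn x → DiophFn y → Dioph {v | y v ∈ F (x v)} := by
  induction hF with
  | zero =>
    intro α x y dx dy
    exact (eq_dioph dy (cd 0)).ext fun v => by simp [pure, PFun.pure]
  | succ =>
    intro α x y dx dy
    exact (eq_dioph dy (add_dioph dx (cd 1))).ext fun v => by simp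
  | left =>
    intro α x y dx dy
    exact (eq_dioph dy (fst_dioph dx)).ext fun v => by simp
  | right =>
    intro α x y dx dy
    exact (eq_dioph dy (snd_dioph dx)).ext fun v => by simp
  | pair _ _ ihf ihg =>
    intro α x y dx dy
    refine (dand (ihf dx (fst_dioph dy)) (ihg dx (snd_dioph dy))).ext fun v => ?_
    simp only [Set.mem_ofPred_eq, Seq.seq, Part.mem_bind_iff, Part.map_eq_map, Part.mem_map_iff]
    constructor
    · rintro ⟨h1, h2⟩
      exact ⟨_, ⟨_, h1, rfl⟩, _, h2, by simp⟩
    · rintro ⟨_, ⟨a, ha, rfl⟩, b, hb, h⟩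
      rw [← h]; simpa using ⟨ha, hb⟩
  | @comp f g _ _ ihf ihg =>
    intro α x y dx dy
    refine (dex (R := fun v z => z ∈ g (x v) ∧ y v ∈ f z)
      (dand (ihg (dlift dx) dnone) (ihf dnone (dlift dy)))).ext fun v => ?_
    exact Part.mem_bind_iff.symm
  | @prec f g _ _ ihf ihg =>
    intro α x y dx dy
    have dbody := dball (α := Option α)
      (R := fun w i => Nat.beta (w none) (i + 1) ∈
        g (Nat.pair (x fun j => w (some j)).unpair.1 (Nat.pair i (Nat.beta (w none) i))))
      (ihg (pair_dioph (dlift (dlift (fst_dioph dx)))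
        (pair_dioph dnone (beta_dioph (dlift dnone) dnone)))
        (beta_dioph (dlift dnone) (add_dioph dnone (cd 1)))) (dlift (snd_dioph dx))
    refine (dex (R := fun v s => Nat.beta s 0 ∈ f (x v).unpair.1 ∧
      Nat.beta s (x v).unpair.2 = y v ∧ ∀ i < (x v).unpair.2,
        Nat.beta s (i + 1) ∈ g (Nat.pair (x v).unpair.1 (Nat.pair i (Nat.beta s i)))) (dand (ihf (dlift (fst_dioph dx)) (beta_dioph dnone (cd 0)))
      (dand (eq_dioph (beta_dioph dnone (dlift (snd_dioph dx))) (dlift dy)) dbody))).ext fun v => ?_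
    exact (prec_iff _ _ _ _ _).symm
  | @rfind f _ ihf =>
    intro α x y dx dy
    have dbody := dball (α := α) (R := fun v m => ∃ z, z ∈ f (Nat.pair (x v) m) ∧ 0 < z)
      (dex (R := fun w z => z ∈ f (Nat.pair (x fun i => w (some i)) (w none)) ∧ 0 < z)
        (dand (ihf (pair_dioph (dlift (dlift dx)) (dlift dnone)) dnone)
        (lt_dioph (cd 0) dnone))) dy
    refine (dand (ihf (pair_dioph dx dy) (cd 0)) dbody).ext fun v => ?_
    refine Iff.trans ?_ Nat.mem_rfind.symm
    simp only [Set.mem_ofPred_eq, Part.map_eq_map, Part.mem_map_iff]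
    constructor
    · rintro ⟨h1, h2⟩
      refine ⟨⟨0, h1, by simp⟩, fun {m} hm => ?_⟩
      obtain ⟨z, hz, h0⟩ := h2 m hm
      exact ⟨z, hz, by simpa using h0.ne'⟩
    · rintro ⟨⟨a, ha, h0⟩, h2⟩
      have : a = 0 := by simpa using h0
      refine ⟨this ▸ ha, fun m hm => ?_⟩
      obtain ⟨z, hz, h0⟩ := h2 hm
      exact ⟨z, hz, Nat.pos_of_ne_zero (by simpa using h0)⟩

end

section

open Dioph

/-! ### From equations to sketches -/

/-- The guard `x ≥ a + as·p`. -/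
def gGe (a : Coeff) (as : List Coeff) : SGuard := (.inl 1, 0, true, a, as)

/-- The guard `x < a + as·p`. -/
def gLt (a : Coeff) (as : List Coeff) : SGuard := (.inl 1, 0, false, a, as)

/-- Guard lists which are satisfiable iff `a + as = b` is violated. -/
def eqGL (a b : Coeff) (as : List Coeff) : List (List SGuard) :=
  [[gGe a as, gLt b []], [gGe b [], gLt a as]]

/-- Guard lists which are satisfiable iff `i * j = k` is violated. -/
def mulGL (i j k : ℕ) : List (List SGuard) :=
  [[gGe (.inr j) [], gLt (.inr j) [.inl 1], (.inr i, 0, false, .inr k, [])],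
   [gGe (.inr j) [], gLt (.inr j) [.inl 1], (.inr i, 0, true, .inr k, [.inl 1])]]

/-- Some guard list is satisfied for some value of the shared variable. -/
def Viol (μ : ℕ → ℤ) (gls : List (List SGuard)) : Prop :=
  ∃ x : ℕ, ∃ gl ∈ gls, ∀ gd ∈ gl, SGuard.sat μ (fun _ => x) (fun _ => 1) gd

theorem viol_append (μ : ℕ → ℤ) (G H : List (List SGuard)) :
    Viol μ (G ++ H) ↔ Viol μ G ∨ Viol μ H := by
  constructor
  · rintro ⟨x, gl, h, h'⟩
    rcases List.mem_append.1 h with h | h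
    · exact Or.inl ⟨x, gl, h, h'⟩
    · exact Or.inr ⟨x, gl, h, h'⟩
  · rintro (⟨x, gl, h, h'⟩ | ⟨x, gl, h, h'⟩)
    · exact ⟨x, gl, List.mem_append_left _ h, h'⟩
    · exact ⟨x, gl, List.mem_append_right _ h, h'⟩

theorem viol_flatMap {ι : Type} (μ : ℕ → ℤ) (l : List ι) (F : ι → List (List SGuard)) :
    Viol μ (l.flatMap F) ↔ ∃ e ∈ l, Viol μ (F e) := by
  constructor
  · rintro ⟨x, gl, h, h'⟩
    obtain ⟨e, he, h⟩ := List.mem_flatMap.1 h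
    exact ⟨e, he, x, gl, h, h'⟩
  · rintro ⟨e, he, x, gl, h, h'⟩
    exact ⟨x, gl, List.mem_flatMap.2 ⟨e, he, h⟩, h'⟩

/-- The value `a + Σ as` of a right-hand side when the environment variables are `1`. -/
def rhsVal (μ : ℕ → ℤ) (a : Coeff) (as : List Coeff) : ℤ :=
  a.eval μ + ∑ i ∈ Finset.range as.length, (as.getD i (.inl 0)).eval μ

theorem sat_gGe (μ : ℕ → ℤ) (x : ℕ) (a : Coeff) (as : List Coeff) :
    SGuard.sat μ (fun _ => x) (fun _ => 1) (gGe a as) ↔ rhsVal μ a as ≤ x := by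
  simp [SGuard.sat, gGe, rhsVal, Coeff.eval]

theorem sat_gLt (μ : ℕ → ℤ) (x : ℕ) (a : Coeff) (as : List Coeff) :
    SGuard.sat μ (fun _ => x) (fun _ => 1) (gLt a as) ↔ (x : ℤ) < rhsVal μ a as := by
  simp [SGuard.sat, gLt, rhsVal, Coeff.eval]

theorem viol_eqGL (μ : ℕ → ℤ) (a b : Coeff) (as : List Coeff)
    (ha : 0 ≤ rhsVal μ a as) (hb : 0 ≤ rhsVal μ b []) :
    Viol μ (eqGL a b as) ↔ rhsVal μ a as ≠ rhsVal μ b [] := by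
  constructor
  · rintro ⟨x, gl, h, h'⟩
    simp only [eqGL, List.mem_cons, List.not_mem_nil, or_false] at h
    rcases h with rfl | rfl <;>
      simp only [List.mem_cons, List.not_mem_nil, or_false, forall_eq_or_imp, forall_eq,
        sat_gGe, sat_gLt] at h' <;> omega
  · intro h
    rcases lt_or_gt_of_ne h with h | h
    · refine ⟨(rhsVal μ a as).toNat, [gGe a as, gLt b []], by simp [eqGL], ?_⟩
      simp only [List.mem_cons, List.not_mem_nil, or_false, forall_eq_or_imp, forall_eq,
        sat_gGe, sat_gLt]
      omega
    · refine ⟨(rhsVal μ b []).toNat, [gGe b [], gLt a as], by simp [eqGL], ?_⟩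
      simp only [List.mem_cons, List.not_mem_nil, or_false, forall_eq_or_imp, forall_eq,
        sat_gGe, sat_gLt]
      omega

theorem viol_mulGL (μ : ℕ → ℤ) (i j k : ℕ) (hj : 0 ≤ μ j) :
    Viol μ (mulGL i j k) ↔ μ i * μ j ≠ μ k := by
  have e1 : ∀ x : ℕ, SGuard.sat μ (fun _ => x) (fun _ => 1) (.inr i, 0, false, .inr k, []) ↔
      μ i * x < μ k := by intro x; simp [SGuard.sat, Coeff.eval]
  have e2 : ∀ x : ℕ, SGuard.sat μ (fun _ => x) (fun _ => 1)
      (.inr i, 0, true, .inr k, [.inl 1]) ↔ μ k + 1 ≤ μ i * x := by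
    intro x; simp [SGuard.sat, Coeff.eval]
  have e3 : rhsVal μ (.inr j) [] = μ j := by simp [rhsVal, Coeff.eval]
  have e4 : rhsVal μ (.inr j) [.inl 1] = μ j + 1 := by simp [rhsVal, Coeff.eval]
  constructor
  · rintro ⟨x, gl, h, h'⟩
    simp only [mulGL, List.mem_cons, List.not_mem_nil, or_false] at h
    rcases h with rfl | rfl <;>
      simp only [List.mem_cons, List.not_mem_nil, or_false, forall_eq_or_imp, forall_eq,
        sat_gGe, sat_gLt, e1, e2, e3, e4] at h' <;>
      obtain ⟨h1, h2, h3⟩ := h' <;>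
      have hx : (x : ℤ) = μ j := by omega
    · rw [hx] at h3; omega
    · rw [hx] at h3; omega
  · intro h
    have hx : ((μ j).toNat : ℤ) = μ j := by omega
    rcases lt_or_gt_of_ne h with h | h
    · refine ⟨(μ j).toNat, [gGe (.inr j) [], gLt (.inr j) [.inl 1],
        (.inr i, 0, false, .inr k, [])], by simp [mulGL], ?_⟩
      simp only [List.mem_cons, List.not_mem_nil, or_false, forall_eq_or_imp, forall_eq,
        sat_gGe, sat_gLt, e1, e2, e3, e4, hx]
      omega
    · refine ⟨(μ j).toNat, [gGe (.inr j) [], gLt (.inr j) [.inl 1],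
        (.inr i, 0, true, .inr k, [.inl 1])], by simp [mulGL], ?_⟩
      simp only [List.mem_cons, List.not_mem_nil, or_false, forall_eq_or_imp, forall_eq,
        sat_gGe, sat_gLt, e1, e2, e3, e4, hx]
      omega

/-- A guard mentioning only shared variable `0` and environment variable `0`. -/
def GoodGuard (gd : SGuard) : Prop := gd.2.1 = 0 ∧ gd.2.2.2.2.length ≤ 1

/-- All guards in the guard lists are good. -/
def GoodGL (gls : List (List SGuard)) : Prop := ∀ gl ∈ gls, ∀ gd ∈ gl, GoodGuard gd

theorem good_eqGL (a b : Coeff) (as : List Coeff) (h : as.length ≤ 1) : GoodGL (eqGL a b as) := by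
  intro gl hgl gd hgd
  simp only [eqGL, List.mem_cons, List.not_mem_nil, or_false] at hgl
  rcases hgl with rfl | rfl <;> simp only [List.mem_cons, List.not_mem_nil, or_false] at hgd <;>
    rcases hgd with rfl | rfl <;> simp [GoodGuard, gGe, gLt, h]

theorem good_mulGL (i j k : ℕ) : GoodGL (mulGL i j k) := by
  intro gl hgl gd hgd
  simp only [mulGL, List.mem_cons, List.not_mem_nil, or_false] at hgl
  rcases hgl with rfl | rfl <;> simp only [List.mem_cons, List.not_mem_nil, or_false] at hgd <;>
    rcases hgd with rfl | rfl | rfl <;> simp [GoodGuard, gGe, gLt]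

theorem good_append {G H : List (List SGuard)} (hG : GoodGL G) (hH : GoodGL H) :
    GoodGL (G ++ H) := by
  intro gl h
  rcases List.mem_append.1 h with h | h
  · exact hG gl h
  · exact hH gl h

theorem good_flatMap {ι : Type} (l : List ι) (F : ι → List (List SGuard))
    (h : ∀ e, GoodGL (F e)) : GoodGL (l.flatMap F) := by
  intro gl hgl
  obtain ⟨e, _, h'⟩ := List.mem_flatMap.1 hgl
  exact h e gl h'

theorem sat_good (μ : ℕ → ℤ) (g pv : ℕ → ℕ) (gd : SGuard) (hg : GoodGuard gd) (hp : pv 0 = 1) :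
    SGuard.sat μ g pv gd ↔ SGuard.sat μ (fun _ => g 0) (fun _ => 1) gd := by
  obtain ⟨b, x, isGe, a0, as⟩ := gd
  obtain ⟨h1, h2⟩ := hg
  simp only at h1 h2
  subst h1
  have : ∀ i ∈ Finset.range as.length, (as.getD i (.inl 0)).eval μ * (pv i : ℤ) =
      (as.getD i (.inl 0)).eval μ * ((1 : ℕ) : ℤ) := by
    intro i hi
    have : i < as.length := by simpa using hi
    have : i = 0 := by omega
    rw [this, hp]
  simp only [SGuard.sat]
  rw [Finset.sum_congr rfl this]

/-- The environment of the reduction: variable `0` equals `1`, variable `1` is the number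
of processes. -/
def theEnv : Env := (2, [([1], -1), ([-1], 1)], ([0, 1], 0))

/-- The sketch of the reduction. -/
def theTA (rs : List SRule) : Sketch := (3, [0], 1, (0, 1, [], [true]) :: rs)

/-- Rules going to the error location. -/
def toRules (gls : List (List SGuard)) : List SRule := gls.map fun gl => (0, 2, gl, [])

theorem theTA_acyclic (gls : List (List SGuard)) : SketchAcyclic (theTA (toRules gls)) := by
  have key : ∀ a b, Relation.TransGen
      (fun u w => ∃ r ∈ (theTA (toRules gls)).2.2.2, r.1 = u ∧ r.2.1 = w) a b → a < b := by
    intro a b h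
    have edge : ∀ u w, (∃ r ∈ (theTA (toRules gls)).2.2.2, r.1 = u ∧ r.2.1 = w) → u < w := by
      rintro u w ⟨r, hr, rfl, rfl⟩
      simp only [theTA, toRules, List.mem_cons, List.mem_map] at hr
      rcases hr with rfl | ⟨gl, _, rfl⟩ <;> simp
    induction h with
    | single h => exact edge _ _ h
    | tail _ h ih => exact ih.trans (edge _ _ h)
  intro a h
  exact lt_irrefl _ (key a a h)

theorem covers_iff (μ : ℕ → ℤ) (gls : List (List SGuard)) (hG : GoodGL gls) :
    Covers theEnv (theTA (toRules gls)) μ 2 ↔ Viol μ gls := by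
  constructor
  · rintro ⟨C, C', hC, hreach, hpos⟩
    obtain ⟨⟨hrc, _, _⟩, hinit, _⟩ := hC
    have hp0 : C.p 0 = 1 := by
      have h1 := hrc ([1], -1) (by simp [theEnv])
      have h2 := hrc ([-1], 1) (by simp [theEnv])
      simp [LinExpr.evalAt] at h1 h2
      omega
    have inv : C'.p 0 = 1 ∧ (0 < C'.κ 2 → Viol μ gls) := by
      clear hpos
      induction hreach with
      | refl =>
        refine ⟨hp0, fun h => ?_⟩
        have := hinit 2 (by simp [theTA])
        omega
      | @tail D E _ hstep ih =>
        obtain ⟨r, hr, hκ, hgd, hp, hg, hκ'⟩ := hstep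
        refine ⟨by rw [hp, ih.1], fun h => ?_⟩
        simp only [theTA, toRules, List.mem_cons, List.mem_map] at hr
        rcases hr with rfl | ⟨gl, hgl, rfl⟩
        · have := hκ' 2
          simp at this
          exact ih.2 (by omega)
        · refine ⟨D.g 0, gl, hgl, fun gd hm => ?_⟩
          exact (sat_good μ D.g D.p gd (hG gl hgl gd hm) ih.1).1 (hgd gd hm)
    exact inv.2 hpos
  · rintro ⟨x, gl, hgl, hsat⟩
    let pv : ℕ → ℕ := fun i => if i = 0 then 1 else x + 1
    let K : ℕ → Config := fun j =>
      ⟨fun i => if i = 0 then x + 1 - j else if i = 1 then j else 0,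
        fun i => if i = 0 then j else 0, pv⟩
    have hreach : ∀ j ≤ x, Relation.ReflTransGen (Step (theTA (toRules gls)) μ) (K 0) (K j) := by
      intro j
      induction j with
      | zero => intro _; exact Relation.ReflTransGen.refl
      | succ j ih =>
        intro hj
        refine (ih (by omega)).tail ⟨(0, 1, [], [true]), by simp [theTA], ?_, by simp, ?_, ?_, ?_⟩
        · simp [K]; omega
        · intro i; rfl
        · intro i
          rcases i with _ | i <;> simp [K]
        · intro i
          simp only [K]
          rcases i with _ | _ | i <;> simp
          omega
    refine ⟨K 0, ⟨fun i => if i = 0 then x + 1 - x - 1 else if i = 1 then x else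
      if i = 2 then 1 else 0, fun i => if i = 0 then x else 0, pv⟩, ?_, (hreach x le_rfl).tail
      ⟨(0, 2, gl, []), ?_, ?_, ?_, ?_, ?_, ?_⟩, ?_⟩
    · refine ⟨⟨?_, ?_, ?_⟩, ?_, ?_⟩
      · intro c hc
        simp only [theEnv, List.mem_cons, List.not_mem_nil, or_false] at hc
        rcases hc with rfl | rfl <;> simp [LinExpr.evalAt, K, pv]
      · simp [theTA, theEnv, LinExpr.evalAt, K, pv, Finset.sum_range_succ]
      · intro i hi
        have hi : 3 ≤ i := hi
        simp [K]; omega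
      · intro i hi
        have : i ≠ 0 := by simpa [theTA] using hi
        simp [K, this]
      · intro j; simp [K]
    · simp [theTA, toRules, hgl]
    · simp [K]
    · intro gd hm
      refine (sat_good μ _ _ gd (hG gl hgl gd hm) ?_).2 ?_
      · simp [K, pv]
      · simpa [K] using hsat gd hm
    · intro i; rfl
    · intro j; simp [K]
    · intro i
      simp only [K]
      rcases i with _ | _ | _ | i <;> simp
    · simp

/-! ### From expressions to guard lists -/

namespace NExpr
variable {γ : Type}

/-- All subexpressions. -/
def subs : NExpr γ → List (NExpr γ)
  | var i => [var i]
  | const c => [const c]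
  | add a b => add a b :: (a.subs ++ b.subs)
  | mul a b => mul a b :: (a.subs ++ b.subs)

theorem self_mem_subs (e : NExpr γ) : e ∈ e.subs := by cases e <;> simp [subs]

/-- The guard lists describing the value of one expression through its direct subexpressions. -/
def nodeGL (idx : NExpr γ → ℕ) : NExpr γ → List (List SGuard)
  | var _ => []
  | const c => eqGL (.inl c) (.inr (idx (const c))) []
  | add a b => eqGL (.inr (idx a)) (.inr (idx (add a b))) [.inr (idx b)]
  | mul a b => mulGL (idx a) (idx b) (idx (mul a b))

theorem good_nodeGL (idx : NExpr γ → ℕ) (e : NExpr γ) : GoodGL (nodeGL idx e) := by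
  cases e with
  | var i => intro gl h; simp [nodeGL] at h
  | const c => exact good_eqGL _ _ _ (by simp)
  | add a b => exact good_eqGL _ _ _ (by simp)
  | mul a b => exact good_mulGL _ _ _

/-- Correctness of the value of one node. -/
def nodeOK (idx : NExpr γ → ℕ) (μ : ℕ → ℤ) : NExpr γ → Prop
  | var _ => True
  | const c => (c : ℤ) = μ (idx (const c))
  | add a b => μ (idx a) + μ (idx b) = μ (idx (add a b))
  | mul a b => μ (idx a) * μ (idx b) = μ (idx (mul a b))

theorem viol_nodeGL (idx : NExpr γ → ℕ) (μ : ℕ → ℤ) (hμ : ∀ i, 0 ≤ μ i) (e : NExpr γ) :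
    Viol μ (nodeGL idx e) ↔ ¬ nodeOK idx μ e := by
  cases e with
  | var i => simp [nodeGL, nodeOK, Viol]
  | const c =>
    rw [nodeGL, viol_eqGL] <;> simp [rhsVal, Coeff.eval, nodeOK, hμ]
  | add a b =>
    have := hμ (idx a)
    have := hμ (idx b)
    rw [nodeGL, viol_eqGL] <;> simp [rhsVal, Coeff.eval, nodeOK, hμ]
    omega
  | mul a b =>
    rw [nodeGL, viol_mulGL _ _ _ _ (hμ _)]; simp [nodeOK]

theorem eval_of_ok (idx : NExpr γ → ℕ) (μ : ℕ → ℤ) (t : γ → ℕ) (ht : ∀ i, (t i : ℤ) = μ (idx (var i)))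
    (e : NExpr γ) (h : ∀ s ∈ e.subs, nodeOK idx μ s) : (e.eval t : ℤ) = μ (idx e) := by
  induction e with
  | var i => exact ht i
  | const c => exact h _ (self_mem_subs _)
  | add a b iha ihb =>
    have h1 := h _ (self_mem_subs _)
    have ha := iha fun s hs => h s (by simp [subs, hs])
    have hb := ihb fun s hs => h s (by simp [subs, hs])
    simp only [nodeOK] at h1
    simp only [eval]
    push_cast
    rw [ha, hb, h1]
  | mul a b iha ihb =>
    have h1 := h _ (self_mem_subs _)
    have ha := iha fun s hs => h s (by simp [subs, hs])
    have hb := ihb fun s hs => h s (by simp [subs, hs])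
    simp only [nodeOK] at h1
    simp only [eval]
    push_cast
    rw [ha, hb, h1]

theorem ok_of_eval (idx : NExpr γ → ℕ) (μ : ℕ → ℤ) (t : γ → ℕ)
    (e : NExpr γ) (h : ∀ s ∈ e.subs, μ (idx s) = (s.eval t : ℤ)) :
    ∀ s ∈ e.subs, nodeOK idx μ s := by
  induction e with
  | var i => intro s hs; simp only [subs, List.mem_singleton] at hs; subst hs; trivial
  | const c =>
    intro s hs; simp only [subs, List.mem_singleton] at hs; subst hs
    exact (h _ (self_mem_subs _)).symm
  | add a b iha ihb =>
    have ha : ∀ s ∈ a.subs, μ (idx s) = (s.eval t : ℤ) := fun s hs => h s (by simp [subs, hs])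
    have hb : ∀ s ∈ b.subs, μ (idx s) = (s.eval t : ℤ) := fun s hs => h s (by simp [subs, hs])
    intro s hs
    simp only [subs, List.mem_cons, List.mem_append] at hs
    rcases hs with rfl | hs | hs
    · simp only [nodeOK]
      rw [h _ (self_mem_subs _), ha _ (self_mem_subs _), hb _ (self_mem_subs _)]
      simp [eval]
    · exact iha ha s hs
    · exact ihb hb s hs
  | mul a b iha ihb =>
    have ha : ∀ s ∈ a.subs, μ (idx s) = (s.eval t : ℤ) := fun s hs => h s (by simp [subs, hs])
    have hb : ∀ s ∈ b.subs, μ (idx s) = (s.eval t : ℤ) := fun s hs => h s (by simp [subs, hs])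
    intro s hs
    simp only [subs, List.mem_cons, List.mem_append] at hs
    rcases hs with rfl | hs | hs
    · simp only [nodeOK]
      rw [h _ (self_mem_subs _), ha _ (self_mem_subs _), hb _ (self_mem_subs _)]
      simp [eval]
    · exact iha ha s hs
    · exact ihb hb s hs

end NExpr

/-- Every Diophantine set of numbers reduces to coefficient synthesis, through a sketch in which
only one constant depends on the input. -/
theorem dioph_reduces {S : Set (Unit → ℕ)} (d : Dioph S) :
    ∃ (i₀ : ℕ) (gls : List (List SGuard)), GoodGL gls ∧ ∀ m : ℕ,
      ((fun _ => m) ∈ S ↔ ∃ μ : ℕ → ℤ, (∀ x, 0 ≤ μ x) ∧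
        ¬ Viol μ (eqGL (.inl m) (.inr i₀) [] ++ gls)) := by
  classical
  obtain ⟨β, p, n, h⟩ := exists_expr d
  let L : List (NExpr (Unit ⊕ β)) := NExpr.var (Sum.inl ()) :: (p.subs ++ n.subs)
  let idx : NExpr (Unit ⊕ β) → ℕ := fun e => L.idxOf e
  refine ⟨idx (NExpr.var (Sum.inl ())),
    eqGL (.inr (idx p)) (.inr (idx n)) [] ++
      (p.subs ++ n.subs).flatMap (NExpr.nodeGL idx), ?_, ?_⟩
  · exact good_append (good_eqGL _ _ _ (by simp)) (good_flatMap _ _ (NExpr.good_nodeGL idx))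
  intro m
  have hviol : ∀ μ : ℕ → ℤ, (∀ x, 0 ≤ μ x) →
      (¬ Viol μ (eqGL (.inl m) (.inr (idx (NExpr.var (Sum.inl ())))) [] ++
        (eqGL (.inr (idx p)) (.inr (idx n)) [] ++
          (p.subs ++ n.subs).flatMap (NExpr.nodeGL idx))) ↔
      ((m : ℤ) = μ (idx (NExpr.var (Sum.inl ()))) ∧ μ (idx p) = μ (idx n) ∧
        ∀ s ∈ p.subs ++ n.subs, NExpr.nodeOK idx μ s)) := by
    intro μ hμ
    rw [viol_append, viol_append, viol_flatMap, viol_eqGL, viol_eqGL]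
    · simp only [NExpr.viol_nodeGL idx μ hμ]
      simp only [rhsVal, Coeff.eval, List.length_nil, Finset.range_zero, Finset.sum_empty,
        add_zero, not_or, not_exists, not_and, not_not, ne_eq]
    all_goals simp [rhsVal, Coeff.eval, hμ]
  rw [h]
  constructor
  · rintro ⟨t, ht⟩
    let T : Unit ⊕ β → ℕ := Sum.elim (fun _ => m) t
    let μ : ℕ → ℤ := fun i => ((L[i]?.getD (NExpr.const 0)).eval T : ℤ)
    have hμ : ∀ x, 0 ≤ μ x := fun x => Int.natCast_nonneg _
    have hidx : ∀ s ∈ L, μ (idx s) = (s.eval T : ℤ) := by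
      intro s hs
      simp only [μ, idx]
      rw [List.getElem?_idxOf hs]
      rfl
    refine ⟨μ, hμ, (hviol μ hμ).2 ⟨?_, ?_, ?_⟩⟩
    · rw [hidx _ (by simp [L])]; simp [NExpr.eval, T]
    · rw [hidx p (by simp [L, NExpr.self_mem_subs]), hidx n (by simp [L, NExpr.self_mem_subs])]
      exact_mod_cast ht
    · intro s hs
      rcases List.mem_append.1 hs with hs | hs
      · exact NExpr.ok_of_eval idx μ T p (fun s hs => hidx s (by simp [L, hs])) s hs
      · exact NExpr.ok_of_eval idx μ T n (fun s hs => hidx s (by simp [L, hs])) s hs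
  · rintro ⟨μ, hμ, hv⟩
    obtain ⟨h1, h2, h3⟩ := (hviol μ hμ).1 hv
    let T : Unit ⊕ β → ℕ := fun i => (μ (idx (NExpr.var i))).toNat
    have hT : ∀ i, (T i : ℤ) = μ (idx (NExpr.var i)) := fun i => Int.toNat_of_nonneg (hμ _)
    have hTe : Sum.elim (fun _ => m) (fun b => T (Sum.inr b)) = T := by
      funext i
      rcases i with _ | b
      · have := hT (Sum.inl ())
        simp only [Sum.elim_inl]
        rw [← h1] at this
        exact_mod_cast this.symm
      · rfl
    refine ⟨fun b => T (Sum.inr b), ?_⟩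
    rw [hTe]
    have hp := NExpr.eval_of_ok idx μ T hT p fun s hs => h3 s (by simp [hs])
    have hn := NExpr.eval_of_ok idx μ T hT n fun s hs => h3 s (by simp [hs])
    rw [h2, ← hn] at hp
    exact_mod_cast hp

/-! ### Computability of the reduction -/

theorem primrec_natCast_int : Primrec (fun n : ℕ => (n : ℤ)) := by
  refine Primrec.encode_iff.1 ?_
  refine (Primrec.nat_mul.comp (Primrec.const 2) Primrec.id).of_eq fun n => ?_
  rfl

theorem toRules_append (G H : List (List SGuard)) :
    toRules (G ++ H) = toRules G ++ toRules H := by simp [toRules]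

theorem computable_inst (i₀ : ℕ) (gls : List (List SGuard)) :
    Computable (fun m : ℕ =>
      ((theEnv, theTA (toRules (eqGL (.inl (m : ℤ)) (.inr i₀) [] ++ gls)), 2) : Instance)) := by
  apply Primrec.to_comp
  have hm : Primrec (fun m : ℕ => (Sum.inl (m : ℤ) : Coeff)) :=
    Primrec.sumInl.comp primrec_natCast_int
  have hge : Primrec (fun m : ℕ => gGe (.inl (m : ℤ)) []) :=
    (Primrec.const (Sum.inl 1 : Coeff)).pair ((Primrec.const 0).pair ((Primrec.const true).pair
      (hm.pair (Primrec.const []))))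
  have hlt : Primrec (fun m : ℕ => gLt (.inl (m : ℤ)) []) :=
    (Primrec.const (Sum.inl 1 : Coeff)).pair ((Primrec.const 0).pair ((Primrec.const false).pair
      (hm.pair (Primrec.const []))))
  have hr1 : Primrec (fun m : ℕ => ((0, 2, [gGe (.inl (m : ℤ)) [], gLt (.inr i₀) []], []) : SRule)) :=
    (Primrec.const 0).pair ((Primrec.const 2).pair
      ((Primrec.list_cons.comp hge (Primrec.const [gLt (.inr i₀) []])).pair (Primrec.const [])))
  have hr2 : Primrec (fun m : ℕ => ((0, 2, [gGe (.inr i₀) [], gLt (.inl (m : ℤ)) []], []) : SRule)) :=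
    (Primrec.const 0).pair ((Primrec.const 2).pair
      ((Primrec.list_cons.comp (Primrec.const (gGe (.inr i₀) []))
        (Primrec.list_cons.comp hlt (Primrec.const []))).pair (Primrec.const [])))
  have hrs : Primrec (fun m : ℕ => (((0, 1, [], [true]) : SRule) ::
      ((0, 2, [gGe (.inl (m : ℤ)) [], gLt (.inr i₀) []], []) : SRule) ::
      ((0, 2, [gGe (.inr i₀) [], gLt (.inl (m : ℤ)) []], []) : SRule) :: toRules gls)) :=
    Primrec.list_cons.comp (Primrec.const _) (Primrec.list_cons.comp hr1
      (Primrec.list_cons.comp hr2 (Primrec.const _)))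
  exact (Primrec.const theEnv).pair (((Primrec.const 3).pair ((Primrec.const [0]).pair
    ((Primrec.const 1).pair hrs))).pair (Primrec.const 2))

end

/-- **Non-negative coefficient synthesis is undecidable** (Theorem 2): there is no algorithm
that, given an environment `Env`, a sketch threshold automaton `TA` over `Env`
and a location `ℓ` of `TA`, decides whether there exists a non-negative integer assignment `μ`
to the indeterminates such that `TA[μ]` cannot cover `ℓ` — even when the input
sketch is required to be acyclic. -/
theorem nonneg_coefficient_synthesis_undecidable :
    ¬ ∃ f : Instance → Bool, Computable f ∧
      ∀ inst : Instance, SketchAcyclic inst.2.1 → inst.2.2 < inst.2.1.1 →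
        (f inst = true ↔
          ∃ μ : ℕ → ℤ, (∀ x, 0 ≤ μ x) ∧ ¬ Covers inst.1 inst.2.1 μ inst.2.2) := by
  rintro ⟨f, hf, hspec⟩
  let F : ℕ →. ℕ := fun m => Nat.Partrec.Code.eval (Denumerable.ofNat Nat.Partrec.Code m) 0
  have hF : Nat.Partrec F := Partrec.nat_iff.1
    (Nat.Partrec.Code.eval_part.comp (Computable.ofNat Nat.Partrec.Code) (Computable.const 0))
  have hS : Dioph {v : Unit → ℕ | ∃ y, y ∈ F (v ())} :=
    dex (R := fun v y => y ∈ F (v ())) (partrec_dioph hF (dlift (Dioph.proj_dioph ())) dnone)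
  obtain ⟨i₀, gls, hGL, hred⟩ := dioph_reduces hS
  apply ComputablePred.halting_problem 0
  rw [ComputablePred.computable_iff]
  refine ⟨fun c => f (theEnv, theTA (toRules (eqGL (.inl ((Encodable.encode c : ℕ) : ℤ))
    (.inr i₀) [] ++ gls)), 2), hf.comp ((computable_inst i₀ gls).comp Computable.encode), ?_⟩
  funext c
  have hgood := good_append (good_eqGL (.inl ((Encodable.encode c : ℕ) : ℤ)) (.inr i₀) []
    (by simp)) hGL
  have h1 := hspec (theEnv, theTA (toRules (eqGL (.inl ((Encodable.encode c : ℕ) : ℤ))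
    (.inr i₀) [] ++ gls)), 2) (theTA_acyclic _) (by simp [theTA])
  simp only [covers_iff _ _ hgood] at h1
  have h2 := hred (Encodable.encode c)
  rw [eq_iff_iff, h1, ← h2]
  simp only [Set.mem_ofPred_eq, F, Denumerable.ofNat_encode]
  exact Part.dom_iff_mem

end ThresholdAutomata
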